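/- arXiv:2212.04194 — 2 statements merged into one kernel-verified Lean document; each statement's English description precedes it below -/
import Mathlib

section
/- Let r be a feasible rate vector such that every circuit i ∈ P has a bottleneck with respect to r, i.e., there exists a node α ∈ N with i ∈ P_α, Σ_{j ∈ P_α} r_j = C_α, and r_i ≥ r_j for all j ∈ P_α. Then r is max-min fair. -/
/-- A rate vector `r : P → ℝ` is feasible: nonnegative, and at each node `α`
the sum of rates of circuits traversing `α` is at most the capacity `C α`. -/
def Feasible {N P : Type*} [Fintype P] (Pmem : N → Finset P) (C : N → ℝ)
    (r : P → ℝ) : Prop :=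
  (∀ i, 0 ≤ r i) ∧ ∀ α, ∑ i ∈ Pmem α, r i ≤ C α

/-- A feasible rate vector `rf` is max-min fair. -/
def MaxMinFair {N P : Type*} [Fintype P] (Pmem : N → Finset P) (C : N → ℝ)
    (rf : P → ℝ) : Prop :=
  Feasible Pmem C rf ∧
    ∀ (i : P) (rb : P → ℝ), Feasible Pmem C rb → rf i ≤ rb i →
      ∃ j : P, rf j ≤ rf i ∧ rb j ≤ rf j

theorem bottleneck_implies_max_min_fair
    {N P : Type*} [Fintype N] [Fintype P]
    (Pmem : N → Finset P) (C : N → ℝ)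
    (hC : ∀ α, 0 < C α)
    (r : P → ℝ) (hr : Feasible Pmem C r)
    (hbot : ∀ i : P, ∃ α : N, i ∈ Pmem α ∧
      (∑ j ∈ Pmem α, r j = C α) ∧ ∀ j ∈ Pmem α, r j ≤ r i) :
    MaxMinFair Pmem C r := by
  refine ⟨hr, fun i rb hrb _ => ?_⟩
  obtain ⟨α, hi, hsum, hmax⟩ := hbot i
  by_contra! h
  have hlt : ∑ j ∈ Pmem α, r j < ∑ j ∈ Pmem α, rb j :=
    Finset.sum_lt_sum_of_nonempty ⟨i, hi⟩ fun j hj => h j (hmax j hj)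
  exact absurd (hrb.2 α) (not_le.mpr (hsum ▸ hlt))
end

section
/- A max-min fair rate vector maximizes the minimum rate: if P is nonempty and r^f is a max-min fair rate vector, then for every feasible rate vector r̄ one has min_{i ∈ P} r̄_i ≤ min_{i ∈ P} r^f_i. -/
theorem max_min_fair_maximizes_min_rate
    {N P : Type*} [Fintype N] [Fintype P]
    (Pmem : N → Finset P) (C : N → ℝ)
    (hC : ∀ α, 0 < C α)
    (hP : (Finset.univ : Finset P).Nonempty)
    (rf : P → ℝ) (hrf : MaxMinFair Pmem C rf)
    (rb : P → ℝ) (hrb : Feasible Pmem C rb) :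
    Finset.univ.inf' hP rb ≤ Finset.univ.inf' hP rf := by
  obtain ⟨i, -, hi⟩ := Finset.exists_mem_eq_inf' hP rf
  rw [hi]
  by_contra! h
  obtain ⟨j, hji, hbj⟩ := hrf.2 i rb hrb (h.le.trans (Finset.inf'_le rb (Finset.mem_univ i)))
  exact (h.trans_le (Finset.inf'_le rb (Finset.mem_univ j))).not_ge (hbj.trans hji)
end
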